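/- Let K be a field, D a division K-algebra such that D ⊗_K D^o is a Noetherian ring, δ₁, …, δ_t pairwise commuting K-derivations of D, and Ev(Δ) ⊆ K^t the group of common eigenvalues. For each subgroup F of Ev(Δ), let 𝔉(F) be the K-linear span in D of all common eigenvectors whose eigenvalue tuple lies in F. Then 𝔉(F) is a K-subalgebra of D which is a domain and is left and right Noetherian as a ring. -/

import Mathlib

open TensorProduct

section Hilbert

variable {K D : Type*} [Field K] [DivisionRing D] [Algebra K D]

/-- Polynomials of degree `< n` in `u` with right coefficients in `R`. -/
def polyLT (R : Subalgebra K D) (u : D) (n : ℕ) : Submodule K D :=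
  Submodule.span K {y | ∃ i < n, ∃ r ∈ R, y = u ^ i * r}

lemma polyLT_mono (R : Subalgebra K D) (u : D) {m n : ℕ} (h : m ≤ n) :
    polyLT R u m ≤ polyLT R u n :=
  Submodule.span_mono fun _ ⟨i, hi, r, hr, e⟩ => ⟨i, lt_of_lt_of_le hi h, r, hr, e⟩

lemma polyLT_zero (R : Subalgebra K D) (u : D) {x : D} (hx : x ∈ polyLT R u 0) : x = 0 := by
  simpa [polyLT] using hx

lemma polyLT_succ (R : Subalgebra K D) (u : D) (n : ℕ) {x : D} (hx : x ∈ polyLT R u (n + 1)) :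
    ∃ r ∈ R, ∃ p ∈ polyLT R u n, x = u ^ n * r + p := by
  induction hx using Submodule.span_induction with
  | mem x hx =>
    obtain ⟨i, hi, r, hr, rfl⟩ := hx
    rcases Nat.lt_succ_iff_lt_or_eq.1 hi with h | rfl
    · exact ⟨0, R.zero_mem, u ^ i * r, Submodule.subset_span ⟨i, h, r, hr, rfl⟩, by simp⟩
    · exact ⟨r, hr, 0, zero_mem _, by simp⟩
  | zero => exact ⟨0, R.zero_mem, 0, zero_mem _, by simp⟩
  | add x y _ _ hx hy =>
    obtain ⟨r, hr, p, hp, rfl⟩ := hx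
    obtain ⟨s, hs, q, hq, rfl⟩ := hy
    exact ⟨r + s, R.add_mem hr hs, p + q, add_mem hp hq, by rw [mul_add]; abel⟩
  | smul c x _ hx =>
    obtain ⟨r, hr, p, hp, rfl⟩ := hx
    exact ⟨c • r, R.smul_mem hr c, c • p, Submodule.smul_mem _ _ hp, by simp⟩

lemma polyLT_mul_u (R : Subalgebra K D) (u : D) (n : ℕ) {x : D} (hx : x ∈ polyLT R u n) :
    u * x ∈ polyLT R u (n + 1) := by
  induction hx using Submodule.span_induction with
  | mem x hx =>
    obtain ⟨i, hi, r, hr, rfl⟩ := hx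
    exact Submodule.subset_span ⟨i + 1, by omega, r, hr, by rw [pow_succ', mul_assoc]⟩
  | zero => simp
  | add x y _ _ hx hy => rw [mul_add]; exact add_mem hx hy
  | smul c x _ hx => rw [mul_smul_comm]; exact Submodule.smul_mem _ _ hx

lemma conj_pow_mem (R : Subalgebra K D) (u : D) (hu : u ≠ 0)
    (h2 : ∀ r ∈ R, u⁻¹ * r * u ∈ R) (n : ℕ) : ∀ r ∈ R, ∃ s ∈ R, r * u ^ n = u ^ n * s := by
  induction n with
  | zero => exact fun r hr => ⟨r, hr, by simp⟩
  | succ n ih =>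
    intro r hr
    obtain ⟨s, hs, e⟩ := ih r hr
    refine ⟨_, h2 s hs, ?_⟩
    rw [pow_succ, ← mul_assoc, e]
    simp [mul_assoc, hu]

lemma conj_pow_mem' (R : Subalgebra K D) (u : D) (hu : u ≠ 0)
    (h1 : ∀ r ∈ R, u * r * u⁻¹ ∈ R) (n : ℕ) : ∀ r ∈ R, ∃ s ∈ R, s * u ^ n = u ^ n * r := by
  induction n with
  | zero => exact fun r hr => ⟨r, hr, by simp⟩
  | succ n ih =>
    intro r hr
    obtain ⟨s, hs, e⟩ := ih _ (h1 r hr)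
    refine ⟨s, hs, ?_⟩
    rw [pow_succ, ← mul_assoc, e]
    simp [mul_assoc, hu]

lemma polyLT_mul_R (R : Subalgebra K D) (u : D) (hu : u ≠ 0)
    (h2 : ∀ r ∈ R, u⁻¹ * r * u ∈ R) (n : ℕ) {s : D} (hs : s ∈ R) {x : D}
    (hx : x ∈ polyLT R u n) : s * x ∈ polyLT R u n := by
  induction hx using Submodule.span_induction with
  | mem x hx =>
    obtain ⟨i, hi, r, hr, rfl⟩ := hx
    obtain ⟨s', hs', e⟩ := conj_pow_mem R u hu h2 i s hs
    exact Submodule.subset_span ⟨i, hi, s' * r, R.mul_mem hs' hr, by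
      rw [← mul_assoc, e, mul_assoc]⟩
  | zero => simp
  | add x y _ _ hx hy => rw [mul_add]; exact add_mem hx hy
  | smul c x _ hx => rw [mul_smul_comm]; exact Submodule.smul_mem _ _ hx

/-- The left ideal of leading coefficients in degree `n`. -/
def leadIdeal (R T : Subalgebra K D) (u : D) (hu : u ≠ 0) (hRT : R ≤ T)
    (h1 : ∀ r ∈ R, u * r * u⁻¹ ∈ R) (h2 : ∀ r ∈ R, u⁻¹ * r * u ∈ R)
    (I : Ideal T) (n : ℕ) : Ideal R where
  carrier := {r | ∃ x ∈ I, ∃ p ∈ polyLT R u n, (x : D) = u ^ n * (r : D) + p}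
  zero_mem' := ⟨0, zero_mem _, 0, zero_mem _, by simp⟩
  add_mem' := by
    rintro a b ⟨x, hx, p, hp, e⟩ ⟨y, hy, q, hq, f⟩
    exact ⟨x + y, add_mem hx hy, p + q, add_mem hp hq, by
      push_cast; rw [e, f, mul_add]; abel⟩
  smul_mem' := by
    rintro c a ⟨x, hx, p, hp, e⟩
    obtain ⟨s, hs, es⟩ := conj_pow_mem' R u hu h1 n c c.2
    refine ⟨⟨s, hRT hs⟩ * x, I.mul_mem_left _ hx, s * p, polyLT_mul_R R u hu h2 n hs hp, ?_⟩
    simp only [smul_eq_mul, MulMemClass.coe_mul]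
    rw [e, mul_add, ← mul_assoc, es, mul_assoc]

theorem hilbert (R T : Subalgebra K D) (u : D) (hu : u ≠ 0) (hRT : R ≤ T)
    (huT : u ∈ T) (huT' : u⁻¹ ∈ T)
    (h1 : ∀ r ∈ R, u * r * u⁻¹ ∈ R) (h2 : ∀ r ∈ R, u⁻¹ * r * u ∈ R)
    (hT : ∀ x ∈ T, ∃ m n : ℕ, u ^ m * x ∈ polyLT R u n)
    (hR : IsNoetherianRing R) : IsNoetherianRing T := by
  let L := leadIdeal R T u hu hRT h1 h2
  have Lmono : ∀ {I J : Ideal T} (n : ℕ), I ≤ J → L I n ≤ L J n := by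
    rintro I J n h r ⟨x, hx, p, hp, e⟩
    exact ⟨x, h hx, p, hp, e⟩
  have Lsucc : ∀ (I : Ideal T) (n : ℕ), L I n ≤ L I (n + 1) := by
    rintro I n r ⟨x, hx, p, hp, e⟩
    refine ⟨⟨u, huT⟩ * x, I.mul_mem_left _ hx, u * p, polyLT_mul_u R u n hp, ?_⟩
    simp only [MulMemClass.coe_mul]
    rw [e, pow_succ', mul_add, mul_assoc]
  have Lmono2 : ∀ (I : Ideal T), Monotone (L I) := fun I => monotone_nat_of_le_succ (Lsucc I)
  have key : ∀ I J : Ideal T, I ≤ J → (∀ n, L J n ≤ L I n) → J ≤ I := by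
    intro I J hIJ hL
    have aux : ∀ n, ∀ x ∈ J, (x : D) ∈ polyLT R u n → x ∈ I := by
      intro n
      induction n with
      | zero =>
        intro x _ hx
        have : x = 0 := Subtype.ext (polyLT_zero R u hx)
        rw [this]; exact zero_mem _
      | succ n ih =>
        intro x hxJ hx
        obtain ⟨r, hr, p, hp, e⟩ := polyLT_succ R u n hx
        have : (⟨r, hr⟩ : R) ∈ L I n := hL n ⟨x, hxJ, p, hp, e⟩
        obtain ⟨y, hy, q, hq, f⟩ := this
        have h3 : x - y ∈ I := by
          refine ih _ (sub_mem hxJ (hIJ hy)) ?_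
          have : ((x - y : T) : D) = p - q := by
            push_cast; rw [e, f]; simp
          rw [this]; exact sub_mem hp hq
        simpa using add_mem h3 hy
    intro x hx
    obtain ⟨m, n, h⟩ := hT x x.2
    have h4 := aux n ((⟨u, huT⟩ : T) ^ m * x) (J.mul_mem_left _ hx) (by simpa using h)
    have h5 := I.mul_mem_left ((⟨u⁻¹, huT'⟩ : T) ^ m) h4
    have : (⟨u⁻¹, huT'⟩ : T) ^ m * ((⟨u, huT⟩ : T) ^ m * x) = x := by
      apply Subtype.ext
      simp [← mul_assoc, hu]
    rwa [this] at h5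
  rw [isNoetherianRing_iff, ← monotone_stabilizes_iff_noetherian]
  intro f
  obtain ⟨M, ⟨⟨k0, N⟩, rfl⟩, hmax⟩ := set_has_maximal_iff_noetherian.2 hR
    (Set.range fun q : ℕ × ℕ => L (f q.1) q.2) ⟨_, ⟨(0, 0), rfl⟩⟩
  have hst : ∀ n, ∃ k, ∀ l, k ≤ l → L (f l) n ≤ L (f k) n := by
    intro n
    obtain ⟨k, hk⟩ := monotone_stabilizes_iff_noetherian.2 hR
      ⟨fun k => L (f k) n, fun a b h => Lmono n (f.monotone h)⟩
    exact ⟨k, fun l hl => (hk l hl).ge⟩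
  choose g hg using hst
  let k1 := k0 + ∑ n ∈ Finset.range N, g n
  refine ⟨k1, fun m hm => le_antisymm (f.monotone hm) (key _ _ (f.monotone hm) fun n => ?_)⟩
  rcases lt_or_ge n N with hn | hn
  · have hgk : g n ≤ k1 := le_trans
      (Finset.single_le_sum (f := g) (fun _ _ => Nat.zero_le _) (Finset.mem_range.2 hn))
      (Nat.le_add_left _ _)
    exact (hg n m (hgk.trans hm)).trans (Lmono n (f.monotone hgk))
  · have hk : k0 ≤ k1 := Nat.le_add_right _ _
    have e1 : L (f k0) N ≤ L (f m) n :=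
      (Lmono N (f.monotone (hk.trans hm))).trans (Lmono2 _ hn)
    have e2 : L (f k0) N ≤ L (f k1) n := (Lmono N (f.monotone hk)).trans (Lmono2 _ hn)
    have e3 : L (f m) n ≤ L (f k0) N := by
      by_contra hc
      exact hmax _ ⟨(m, n), rfl⟩ (lt_of_le_not_ge e1 hc)
    exact e3.trans e2

end Hilbert

section Eig

variable {K D : Type*} [Field K] [DivisionRing D] [Algebra K D] {t : ℕ}

/-- `K`-subalgebra spanned by common eigenvectors with eigenvalue in `G`. -/
def eigAlg (δ : Fin t → (D →ₗ[K] D))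
    (hLeib : ∀ i, ∀ a b : D, δ i (a * b) = δ i a * b + a * δ i b)
    (G : AddSubgroup (Fin t → K)) : Subalgebra K D :=
  Submodule.toSubalgebra
    (Submodule.span K {u : D | ∃ lam ∈ G, ∀ i, δ i u = lam i • u})
    (Submodule.subset_span ⟨0, G.zero_mem, fun i => by
      have := hLeib i 1 1
      simp at this
      simp [this]⟩)
    (by
      intro x y hx hy
      have := Submodule.mul_mem_mul hx hy
      rw [Submodule.span_mul_span] at this
      refine Submodule.span_mono ?_ this
      rintro _ ⟨a, ⟨l, hl, ha⟩, b, ⟨m, hm, hb⟩, rfl⟩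
      refine ⟨l + m, G.add_mem hl hm, fun i => ?_⟩
      simp only [hLeib, ha, hb, Pi.add_apply, add_smul, smul_mul_assoc, mul_smul_comm])

variable {δ : Fin t → (D →ₗ[K] D)}

lemma eig_mul (hLeib : ∀ i, ∀ a b : D, δ i (a * b) = δ i a * b + a * δ i b)
    {l m : Fin t → K} {a b : D} (ha : ∀ i, δ i a = l i • a) (hb : ∀ i, δ i b = m i • b) :
    ∀ i, δ i (a * b) = (l + m) i • (a * b) := fun i => by
  simp only [hLeib, ha, hb, Pi.add_apply, add_smul, smul_mul_assoc, mul_smul_comm]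

lemma eig_one (hLeib : ∀ i, ∀ a b : D, δ i (a * b) = δ i a * b + a * δ i b) :
    ∀ i, δ i (1 : D) = (0 : Fin t → K) i • (1 : D) := fun i => by
  have := hLeib i 1 1
  simp at this
  simp [this]

lemma eig_inv (hLeib : ∀ i, ∀ a b : D, δ i (a * b) = δ i a * b + a * δ i b)
    {l : Fin t → K} {a : D} (ha : ∀ i, δ i a = l i • a) :
    ∀ i, δ i a⁻¹ = (-l) i • a⁻¹ := fun i => by
  by_cases h : a = 0
  · simp [h]
  have h1 := hLeib i a a⁻¹
  rw [mul_inv_cancel₀ h, eig_one hLeib, ha, smul_mul_assoc, mul_inv_cancel₀ h] at h1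
  have h2 : a⁻¹ * (a * δ i a⁻¹) = a⁻¹ * (-(l i • 1)) := by
    congr 1
    simp only [Pi.zero_apply, zero_smul] at h1
    exact (neg_eq_of_add_eq_zero_right h1.symm).symm
  rw [← mul_assoc, inv_mul_cancel₀ h, one_mul] at h2
  rw [h2]; simp

lemma eig_zpow (hLeib : ∀ i, ∀ a b : D, δ i (a * b) = δ i a * b + a * δ i b)
    {l : Fin t → K} {a : D} (ha : ∀ i, δ i a = l i • a) (n : ℕ) :
    ∀ i, δ i (a ^ n) = (n • l) i • (a ^ n) := by
  induction n with
  | zero => simpa using eig_one hLeib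
  | succ n ih => 
    rw [pow_succ, succ_nsmul]
    exact eig_mul hLeib ih ha

lemma mem_eigAlg (hLeib : ∀ i, ∀ a b : D, δ i (a * b) = δ i a * b + a * δ i b)
    {G : AddSubgroup (Fin t → K)} {l : Fin t → K} (hl : l ∈ G) {a : D}
    (ha : ∀ i, δ i a = l i • a) : a ∈ eigAlg δ hLeib G :=
  Submodule.subset_span ⟨l, hl, ha⟩

lemma eigAlg_induction (hLeib : ∀ i, ∀ a b : D, δ i (a * b) = δ i a * b + a * δ i b)
    (G : AddSubgroup (Fin t → K)) (P : Submodule K D)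
    (h : ∀ l ∈ G, ∀ a : D, (∀ i, δ i a = l i • a) → a ∈ P) :
    ∀ x ∈ eigAlg δ hLeib G, x ∈ P := fun x hx =>
  (Submodule.span_le (s := {u : D | ∃ lam ∈ G, ∀ i, δ i u = lam i • u})).2 (fun a ⟨l, hl, ha⟩ => h l hl a ha) hx

lemma eigAlg_mono (hLeib : ∀ i, ∀ a b : D, δ i (a * b) = δ i a * b + a * δ i b)
    {G H : AddSubgroup (Fin t → K)} (h : G ≤ H) : eigAlg δ hLeib G ≤ eigAlg δ hLeib H :=
  Submodule.span_mono (R := K) (s := {u : D | ∃ lam ∈ G, ∀ i, δ i u = lam i • u})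
    (t := {u : D | ∃ lam ∈ H, ∀ i, δ i u = lam i • u}) fun _ ⟨l, hl, ha⟩ => ⟨l, h hl, ha⟩

lemma eigAlg_conj (hLeib : ∀ i, ∀ a b : D, δ i (a * b) = δ i a * b + a * δ i b)
    (G : AddSubgroup (Fin t → K)) {u v : D} {l : Fin t → K} (hu : ∀ i, δ i u = l i • u)
    (hv : ∀ i, δ i v = (-l) i • v) : ∀ r ∈ eigAlg δ hLeib G, u * r * v ∈ eigAlg δ hLeib G := by
  refine eigAlg_induction hLeib G ((Subalgebra.toSubmodule (eigAlg δ hLeib G)).comap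
    ((LinearMap.mulRight K v) ∘ₗ (LinearMap.mulLeft K u))) fun m hm a ha => ?_
  have := eig_mul hLeib (eig_mul hLeib hu ha) hv
  rw [show l + m + -l = m by abel] at this
  exact mem_eigAlg hLeib hm this

lemma eigAlg_bot (hLeib : ∀ i, ∀ a b : D, δ i (a * b) = δ i a * b + a * δ i b) :
    IsNoetherianRing (eigAlg δ hLeib ⊥) := by
  have hinv : ∀ x ∈ eigAlg δ hLeib ⊥, x⁻¹ ∈ eigAlg δ hLeib ⊥ := by
    intro x hx
    have h0 : ∀ i, δ i x = (0 : Fin t → K) i • x := by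
      have := eigAlg_induction hLeib ⊥ (⨅ i, LinearMap.ker (δ i)) (fun l hl a ha => by
        rw [AddSubgroup.mem_bot] at hl
        subst hl
        simpa using ha) x hx
      simpa using this
    have := eig_inv hLeib h0
    rw [neg_zero] at this
    exact mem_eigAlg hLeib (AddSubgroup.zero_mem _) this
  rw [isNoetherianRing_iff_ideal_fg]
  intro I
  by_cases hI : I = ⊥
  · rw [hI]; exact Submodule.fg_bot
  · obtain ⟨x, hx, hx0⟩ := Submodule.exists_mem_ne_zero_of_ne_bot hI
    have : I = ⊤ := by
      rw [Ideal.eq_top_iff_one]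
      have h := I.mul_mem_left ⟨_, hinv x x.2⟩ hx
      have e : (⟨_, hinv x x.2⟩ : eigAlg δ hLeib ⊥) * x = 1 := by
        apply Subtype.ext
        have : (x : D) ≠ 0 := fun h => hx0 (Subtype.ext h)
        simp [this]
      rwa [e] at h
    rw [this]
    exact ⟨{1}, by simp⟩

lemma eigAlg_sup (hLeib : ∀ i, ∀ a b : D, δ i (a * b) = δ i a * b + a * δ i b)
    (G : AddSubgroup (Fin t → K)) {u : D} {l : Fin t → K} (hu0 : u ≠ 0)
    (hu : ∀ i, δ i u = l i • u) (h : IsNoetherianRing (eigAlg δ hLeib G)) :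
    IsNoetherianRing (eigAlg δ hLeib (G ⊔ AddSubgroup.zmultiples l)) := by
  have hl : l ∈ G ⊔ AddSubgroup.zmultiples l :=
    (le_sup_right : _ ≤ G ⊔ _) (AddSubgroup.mem_zmultiples l)
  have hu' := eig_inv hLeib hu
  refine hilbert (eigAlg δ hLeib G) _ u hu0 (eigAlg_mono hLeib le_sup_left)
    (mem_eigAlg hLeib hl hu) (mem_eigAlg hLeib (neg_mem hl) hu')
    (eigAlg_conj hLeib G hu hu') (eigAlg_conj hLeib G hu' (by simpa using hu)) ?_ h
  intro x hx
  induction hx using Submodule.span_induction with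
  | mem x hx =>
    obtain ⟨m, hm, hx⟩ := hx
    obtain ⟨g, hg, _, ⟨k, rfl⟩, rfl⟩ := AddSubgroup.mem_sup.1 hm
    rcases Int.eq_nat_or_neg k with ⟨n, rfl | rfl⟩
    · refine ⟨0, n + 1, Submodule.subset_span ⟨n, by omega, (u ^ n)⁻¹ * x, ?_, ?_⟩⟩
      · refine mem_eigAlg hLeib hg ?_
        have := eig_mul hLeib (eig_inv hLeib (eig_zpow hLeib hu n)) hx
        convert this using 3
        simp
      · simp [hu0]
    · refine ⟨n, 1, Submodule.subset_span ⟨0, by omega, u ^ n * x, ?_, by simp⟩⟩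
      refine mem_eigAlg hLeib hg ?_
      have := eig_mul hLeib (eig_zpow hLeib hu n) hx
      convert this using 3
      simp
  | zero => exact ⟨0, 0, by simp⟩
  | add x y _ _ hx hy =>
    obtain ⟨m, n, h1⟩ := hx
    obtain ⟨m', n', h2⟩ := hy
    have shift : ∀ (j : ℕ) {n : ℕ} {z : D}, z ∈ polyLT (eigAlg δ hLeib G) u n →
        u ^ j * z ∈ polyLT (eigAlg δ hLeib G) u (n + j) := by
      intro j
      induction j with
      | zero => intro n z hz; simpa using hz
      | succ j ih =>
        intro n z hz
        rw [pow_succ', mul_assoc]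
        exact polyLT_mul_u _ _ _ (ih hz)
    refine ⟨m + m', (n + m') + (n' + m), ?_⟩
    rw [mul_add]
    refine add_mem (polyLT_mono _ _ (Nat.le_add_right _ _) ?_)
      (polyLT_mono _ _ (Nat.le_add_left _ _) ?_)
    · rw [add_comm m m', pow_add, mul_assoc]; exact shift _ h1
    · rw [pow_add, mul_assoc]; exact shift _ h2
  | smul c x _ hx =>
    obtain ⟨m, n, h1⟩ := hx
    exact ⟨m, n, by rw [mul_smul_comm]; exact Submodule.smul_mem _ _ h1⟩

lemma eigAlg_fg (hLeib : ∀ i, ∀ a b : D, δ i (a * b) = δ i a * b + a * δ i b)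
    (s : Finset (Fin t → K))
    (hs : ∀ l ∈ s, ∃ u : D, u ≠ 0 ∧ ∀ i, δ i u = l i • u) :
    IsNoetherianRing (eigAlg δ hLeib (AddSubgroup.closure (s : Set (Fin t → K)))) := by
  classical
  induction s using Finset.induction_on with
  | empty =>
    rw [Finset.coe_empty, AddSubgroup.closure_empty]
    exact eigAlg_bot hLeib
  | insert a s ha ih =>
    obtain ⟨u, hu0, hu⟩ := hs a (Finset.mem_insert_self _ _)
    have := eigAlg_sup hLeib _ hu0 hu (ih fun l hl => hs l (Finset.mem_insert_of_mem hl))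
    have e : AddSubgroup.closure ((insert a s : Finset (Fin t → K)) : Set (Fin t → K)) =
        AddSubgroup.closure (s : Set (Fin t → K)) ⊔ AddSubgroup.zmultiples a := by
      rw [Finset.coe_insert, Set.insert_eq, AddSubgroup.closure_union,
        ← AddSubgroup.zmultiples_eq_closure, sup_comm]
    rw [e]; exact this

lemma eig_indep (hcomm : ∀ i j, ∀ x : D, δ i (δ j x) = δ j (δ i x)) :
    iSupIndep fun l : Fin t → K => (⨅ i, Module.End.eigenspace (δ i) (l i) : Submodule K D) := by
  refine (Module.End.independent_iInf_maxGenEigenspace_of_forall_mapsTo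
    (fun i => (δ i : Module.End K D)) ?_).mono fun l =>
      iInf_mono fun i => Module.End.eigenspace_le_maxGenEigenspace
  intro i j φ
  exact Module.End.mapsTo_maxGenEigenspace_of_comm
    (show Commute (δ j : Module.End K D) (δ i) from LinearMap.ext fun x => hcomm j i x) φ

lemma eig_disj (hLeib : ∀ i, ∀ a b : D, δ i (a * b) = δ i a * b + a * δ i b)
    (hcomm : ∀ i j, ∀ x : D, δ i (δ j x) = δ j (δ i x))
    (G : AddSubgroup (Fin t → K)) {a : D} {l : Fin t → K} (hl : l ∉ G) (ha0 : a ≠ 0)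
    (ha : ∀ i, δ i a = l i • a) {x y : D} (hx : x ∈ eigAlg δ hLeib G)
    (hy : y ∈ eigAlg δ hLeib G) (h : x + y * a = 0) : x = 0 ∧ y = 0 := by
  let E : (Fin t → K) → Submodule K D := fun l => ⨅ i, Module.End.eigenspace (δ i) (l i)
  have hE : ∀ {l a}, (∀ i, δ i a = l i • a) → a ∈ E l := by
    intro l a h
    simp only [E, Submodule.mem_iInf, Module.End.mem_eigenspace_iff]
    exact h
  have hd : Disjoint (⨆ m ∈ (G : Set (Fin t → K)), E m)
      (⨆ m ∈ {m : Fin t → K | m - l ∈ G}, E m) := by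
    refine (eig_indep hcomm).disjoint_biSup_biSup ?_
    rw [Set.disjoint_left]
    intro m hm hm'
    apply hl
    have := G.sub_mem hm hm'
    simpa using this
  have h1 : x ∈ ⨆ m ∈ (G : Set (Fin t → K)), E m :=
    eigAlg_induction hLeib G _ (fun m hm b hb => Submodule.mem_iSup_of_mem m
      (Submodule.mem_iSup_of_mem hm (hE hb))) x hx
  have h2 : y * a ∈ ⨆ m ∈ {m : Fin t → K | m - l ∈ G}, E m := by
    refine eigAlg_induction hLeib G (Submodule.comap (LinearMap.mulRight K a)
      (⨆ m ∈ {m : Fin t → K | m - l ∈ G}, E m)) (fun m hm b hb => ?_) y hy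
    exact Submodule.mem_iSup_of_mem (m + l)
      (Submodule.mem_iSup_of_mem (by simpa using hm) (hE (eig_mul hLeib hb ha)))
  have hx' : x = -(y * a) := eq_neg_of_add_eq_zero_left h
  have hx0 : x = 0 := Submodule.disjoint_def.1 hd x h1 (by rw [hx']; exact neg_mem h2)
  refine ⟨hx0, ?_⟩
  rw [hx0, zero_add] at h
  exact (mul_eq_zero.1 h).resolve_right ha0

lemma ore_baer (R : Subalgebra K D) (hR : IsNoetherianRing R) : Module.Baer R D := by
  have ore : ∀ b c : R, b ≠ 0 → ∃ r s : R, r ≠ 0 ∧ r * c = s * b := by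
    intro b c hb
    have := (strongRankCondition_iff_succ R).1 inferInstance 1
      (LinearMap.pi fun _ => (LinearMap.toSpanSingleton R R c) ∘ₗ LinearMap.proj 0 -
        (LinearMap.toSpanSingleton R R b) ∘ₗ LinearMap.proj 1)
    rw [injective_iff_map_eq_zero] at this
    push Not at this
    obtain ⟨v, hv, hv0⟩ := this
    have hv1 := congrFun hv 0
    simp only [LinearMap.pi_apply, LinearMap.sub_apply, LinearMap.comp_apply,
      LinearMap.proj_apply, LinearMap.toSpanSingleton_apply, smul_eq_mul, Pi.zero_apply] at hv1
    have hv2 := sub_eq_zero.1 hv1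
    refine ⟨v 0, v 1, fun h0 => hv0 ?_, hv2⟩
    rw [h0, zero_mul] at hv2
    have h1 := (mul_eq_zero.1 hv2.symm).resolve_right hb
    ext i
    fin_cases i <;> simp [h0, h1]
  intro I g
  by_cases hI : I = ⊥
  · refine ⟨0, fun x hx => ?_⟩
    have : (⟨x, hx⟩ : I) = 0 := Subtype.ext (by simpa [hI] using hx)
    rw [this]; simp
  · obtain ⟨b, hb, hb0⟩ := Submodule.exists_mem_ne_zero_of_ne_bot hI
    have hbD : (b : D) ≠ 0 := fun h => hb0 (Subtype.ext h)
    refine ⟨LinearMap.toSpanSingleton R D ((b : D)⁻¹ * g ⟨b, hb⟩), fun c hc => ?_⟩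
    obtain ⟨r, s, hr, e⟩ := ore b c hb0
    have hrD : (r : D) ≠ 0 := fun h => hr (Subtype.ext h)
    have e1 : r • g ⟨c, hc⟩ = s • g ⟨b, hb⟩ := by
      rw [← map_smul, ← map_smul]
      congr 1
      exact Subtype.ext e
    have e2 : (r : D) * c = s * b := congrArg Subtype.val e
    rw [LinearMap.toSpanSingleton_apply]
    simp only [Subalgebra.smul_def, smul_eq_mul] at e1 ⊢
    apply mul_left_cancel₀ hrD
    rw [e1, ← mul_assoc, e2, mul_assoc, mul_inv_cancel_left₀ hbD]

/-- The left ideal of the enveloping algebra attached to a subalgebra. -/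
def envIdeal (R : Subalgebra K D) : Ideal (D ⊗[K] Dᵐᵒᵖ) :=
  Ideal.span {z | ∃ u ∈ R, z = u ⊗ₜ[K] (1 : Dᵐᵒᵖ) - (1 : D) ⊗ₜ[K] MulOpposite.op u}

lemma envIdeal_detect (hLeib : ∀ i, ∀ a b : D, δ i (a * b) = δ i a * b + a * δ i b)
    (hcomm : ∀ i j, ∀ x : D, δ i (δ j x) = δ j (δ i x))
    (G : AddSubgroup (Fin t → K)) (hN : IsNoetherianRing (eigAlg δ hLeib G))
    {a : D} {l : Fin t → K} (ha0 : a ≠ 0) (ha : ∀ i, δ i a = l i • a)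
    (hmem : a ⊗ₜ[K] (1 : Dᵐᵒᵖ) - (1 : D) ⊗ₜ[K] MulOpposite.op a ∈
      envIdeal (eigAlg δ hLeib G)) : l ∈ G := by
  by_contra hl
  set R := eigAlg δ hLeib G with hRdef
  obtain ⟨θ, hθ⟩ := (ore_baer R hN).extension_property
    (LinearMap.coprod (LinearMap.toSpanSingleton R D (1 : D)) (LinearMap.toSpanSingleton R D a))
    (by
      rw [injective_iff_map_eq_zero]
      rintro ⟨x, y⟩ h
      simp only [LinearMap.coprod_apply, LinearMap.toSpanSingleton_apply,
        Subalgebra.smul_def, smul_eq_mul, mul_one] at h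
      obtain ⟨h1, h2⟩ := eig_disj hLeib hcomm G hl ha0 ha x.2 y.2 h
      exact Prod.ext (Subtype.ext h1) (Subtype.ext h2))
    (LinearMap.coprod (LinearMap.toSpanSingleton R D (1 : D)) 0)
  have hθ1 : θ 1 = 1 := by simpa using LinearMap.congr_fun hθ (1, 0)
  have hθa : θ a = 0 := by simpa using LinearMap.congr_fun hθ (0, 1)
  have hθR : ∀ u ∈ R, ∀ y, θ (u * y) = u * θ y := fun u hu y => θ.map_smul ⟨u, hu⟩ y
  let θK : D →ₗ[K] D :=
    { toFun := θ
      map_add' := map_add θ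
      map_smul' := fun c x => by
        have := hθR _ (R.algebraMap_mem c) x
        simpa [Algebra.smul_def] using this }
  let φ : D ⊗[K] Dᵐᵒᵖ →ₗ[K] D := TensorProduct.lift
    ((LinearMap.mul K D).compl₂ (θK ∘ₗ (MulOpposite.opLinearEquiv K).symm.toLinearMap))
  have hφ : ∀ x y, φ (x ⊗ₜ[K] MulOpposite.op y) = x * θ y := fun x y => rfl
  have hz : ∀ z ∈ envIdeal R, ∀ r, φ (r * z) = 0 := by
    intro z hz
    induction hz using Submodule.span_induction with
    | mem z hz =>
      obtain ⟨u, hu, rfl⟩ := hz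
      intro r
      induction r using TensorProduct.induction_on with
      | zero => simp
      | add x y hx hy => rw [add_mul, map_add, hx, hy, add_zero]
      | tmul x y =>
        induction y using MulOpposite.rec' with
        | _ y =>
        rw [mul_sub, Algebra.TensorProduct.tmul_mul_tmul, Algebra.TensorProduct.tmul_mul_tmul,
          mul_one, mul_one, ← MulOpposite.op_mul, map_sub, hφ, hφ, hθR u hu, mul_assoc, sub_self]
    | zero => simp
    | add x y _ _ hx hy => intro r; rw [mul_add, map_add, hx, hy, add_zero]
    | smul c x _ hx => intro r; rw [smul_eq_mul, ← mul_assoc]; exact hx _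
  have h1 := hz _ hmem 1
  rw [one_mul, map_sub, ← MulOpposite.op_one, hφ, hφ, hθ1, hθa] at h1
  simp at h1
  exact ha0 h1

lemma exists_fg (hNoeth : IsNoetherianRing (D ⊗[K] Dᵐᵒᵖ))
    (hLeib : ∀ i, ∀ a b : D, δ i (a * b) = δ i a * b + a * δ i b)
    (hcomm : ∀ i j, ∀ x : D, δ i (δ j x) = δ j (δ i x))
    (F : AddSubgroup (Fin t → K))
    (hF : ∀ l ∈ F, ∃ u : D, u ≠ 0 ∧ ∀ i, δ i u = l i • u) :
    ∃ s : Finset (Fin t → K), (∀ l ∈ s, l ∈ F) ∧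
      AddSubgroup.closure (s : Set (Fin t → K)) = F := by
  classical
  let J : Finset (Fin t → K) → Ideal (D ⊗[K] Dᵐᵒᵖ) := fun s =>
    envIdeal (eigAlg δ hLeib (AddSubgroup.closure (s : Set (Fin t → K))))
  obtain ⟨_, ⟨s, hs, rfl⟩, hmax⟩ := set_has_maximal_iff_noetherian.2 hNoeth
    (J '' {s | ∀ l ∈ s, l ∈ F}) ⟨_, ⟨∅, by simp, rfl⟩⟩
  refine ⟨s, hs, le_antisymm ((AddSubgroup.closure_le _).2 hs) fun l hl => ?_⟩
  obtain ⟨a, ha0, ha⟩ := hF l hl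
  refine envIdeal_detect hLeib hcomm _ (eigAlg_fg hLeib s fun m hm => hF m (hs m hm)) ha0 ha ?_
  have hle : J s ≤ J (insert l s) := by
    refine Ideal.span_mono ?_
    rintro _ ⟨u, hu, rfl⟩
    exact ⟨u, eigAlg_mono hLeib (AddSubgroup.closure_mono (by simp)) hu, rfl⟩
  have hge : J (insert l s) ≤ J s := by
    by_contra hc
    refine hmax _ ⟨insert l s, ?_, rfl⟩ (lt_of_le_not_ge hle hc)
    intro m hm
    rcases Finset.mem_insert.1 hm with rfl | h
    · exact hl
    · exact hs m h
  exact hge (Ideal.subset_span ⟨a, mem_eigAlg hLeib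
    (AddSubgroup.subset_closure (by simp)) ha, rfl⟩)

end Eig

/-- Let `D` be a division `K`-algebra with `D ⊗[K] Dᵐᵒᵖ` Noetherian,
`δ₁, …, δ_t` pairwise commuting `K`-derivations of `D`.  For every subgroup `F` of the group
of common eigenvalues, the `K`-linear span `𝔉(F)` of the common eigenvectors whose eigenvalue
tuple lies in `F` is a `K`-subalgebra of `D` which is a domain and a left and right
Noetherian ring. -/
theorem stmt7 (K D : Type*) [Field K] [DivisionRing D] [Algebra K D]
    (hNoeth : IsNoetherianRing (D ⊗[K] Dᵐᵒᵖ))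
    (t : ℕ) (δ : Fin t → (D →ₗ[K] D))
    (hLeib : ∀ i, ∀ a b : D, δ i (a * b) = δ i a * b + a * δ i b)
    (hcomm : ∀ i j, ∀ x : D, δ i (δ j x) = δ j (δ i x))
    (F : AddSubgroup (Fin t → K))
    (hF : (F : Set (Fin t → K)) ⊆
      {lam : Fin t → K | ∃ u : D, u ≠ 0 ∧ ∀ i, δ i u = lam i • u}) :
    ∃ S : Subalgebra K D,
      (S : Set D) =
        (Submodule.span K {u : D | ∃ lam ∈ F, ∀ i, δ i u = lam i • u} : Set D) ∧
      IsDomain S ∧ IsNoetherianRing S ∧ IsNoetherianRing Sᵐᵒᵖ := by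
  have hF' : ∀ l ∈ F, ∃ u : D, u ≠ 0 ∧ ∀ i, δ i u = l i • u := fun l hl => hF hl
  obtain ⟨s, hs, rfl⟩ := exists_fg hNoeth hLeib hcomm F hF'
  refine ⟨eigAlg δ hLeib _, rfl, inferInstance,
    eigAlg_fg hLeib s fun l hl => hF' l (AddSubgroup.subset_closure hl), ?_⟩
  let e := MulOpposite.opLinearEquiv K (M := D)
  let δ' : Fin t → (Dᵐᵒᵖ →ₗ[K] Dᵐᵒᵖ) := fun i => e.toLinearMap ∘ₗ δ i ∘ₗ e.symm.toLinearMap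
  have hδ' : ∀ i (x : D), δ' i (MulOpposite.op x) = MulOpposite.op (δ i x) := fun i x => rfl
  have hLeib' : ∀ i, ∀ a b : Dᵐᵒᵖ, δ' i (a * b) = δ' i a * b + a * δ' i b := by
    intro i a b
    induction a using MulOpposite.rec' with
    | _ a =>
    induction b using MulOpposite.rec' with
    | _ b =>
    rw [← MulOpposite.op_mul, hδ', hδ', hδ', hLeib, ← MulOpposite.op_mul, ← MulOpposite.op_mul,
      ← MulOpposite.op_add, add_comm]
  have hN' := eigAlg_fg hLeib' s (fun l hl => by
    obtain ⟨u, hu0, hu⟩ := hF' l (AddSubgroup.subset_closure hl)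
    exact ⟨MulOpposite.op u, by simpa using hu0, fun i => by rw [hδ', hu]; rfl⟩)
  have hS : eigAlg δ' hLeib' (AddSubgroup.closure (s : Set (Fin t → K))) =
      (eigAlg δ hLeib (AddSubgroup.closure (s : Set (Fin t → K)))).op := by
    apply le_antisymm
    · intro x hx
      refine eigAlg_induction hLeib' _ (Subalgebra.toSubmodule (eigAlg δ hLeib
        (AddSubgroup.closure (s : Set (Fin t → K)))).op) (fun l hl a ha => ?_) x hx
      exact mem_eigAlg hLeib hl (a := a.unop) fun i => congrArg MulOpposite.unop (ha i)
    · intro x hx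
      exact eigAlg_induction hLeib _ (Submodule.comap e.toLinearMap (Subalgebra.toSubmodule
        (eigAlg δ' hLeib' (AddSubgroup.closure (s : Set (Fin t → K))))))
        (fun l hl a ha => mem_eigAlg hLeib' hl (a := MulOpposite.op a) fun i => by
          rw [hδ', ha]; rfl) x.unop hx
  rw [hS] at hN'
  have E := (Subalgebra.algEquivOpMop
    (eigAlg δ hLeib (AddSubgroup.closure (s : Set (Fin t → K))))).toRingEquiv
  exact isNoetherianRing_of_ringEquiv _
    ((RingEquiv.opOp _).trans (RingEquiv.op E).symm)
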